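/- Let A and B be countable right-orderable groups, G = A ∗ B, and let w = a₁b₁⋯aₙbₙ ∈ G be a cyclically reduced word of length 2n with n ≥ 1 which is not a proper power (there are no v ∈ G and integer j ≥ 2 with w = vʲ). Let w₁ be a proper prefix of w, i.e., a nonempty prefix of w with w₁ ≠ w. Then there exist a right action τ of G on ℝ by orientation-preserving homeomorphisms and a point x ∈ ℝ such that x·τ(w) = x and x·τ(w₁) ≠ x. -/

import Mathlib

/-- A group is right-orderable if there is a strict total order on it invariant
under right multiplication. -/
def IsRightOrderable (H : Type*) [Group H] : Prop :=
  ∃ lt : H → H → Prop, IsStrictTotalOrder H lt ∧ ∀ f g h : H, lt f g → lt (f * h) (g * h)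

/-- A right action of `G` on `ℝ` by orientation-preserving homeomorphisms, i.e. a map
to order-preserving bijections of `ℝ` satisfying `x·τ(gh) = (x·τ(g))·τ(h)`. -/
def IsRightAction {G : Type*} [Group G] (τ : G → (ℝ ≃o ℝ)) : Prop :=
  ∀ g h : G, τ (g * h) = (τ g).trans (τ h)

/-- The list of letters `a₁, b₁, …, aₙ, bₙ` of the word `w = a₁b₁⋯aₙbₙ` in `A ∗ B`. -/
def wordLetters {A B : Type*} [Group A] [Group B] {n : ℕ}
    (a : Fin n → A) (b : Fin n → B) : List (Monoid.Coprod A B) :=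
  (List.finRange n).flatMap fun i => [Monoid.Coprod.inl (a i), Monoid.Coprod.inr (b i)]

/-- A family of strictly monotone maps satisfying the action axioms is an action by order
automorphisms. -/
def orderActionOfStrictMono {G X : Type*} [Group G] [LinearOrder X] (f : G → X → X)
    (h_one : ∀ x, f 1 x = x) (h_mul : ∀ g h x, f (g * h) x = f g (f h x))
    (h_mono : ∀ g, StrictMono (f g)) : G →* (X ≃o X) where
  toFun g :=
    { toFun := f g
      invFun := f g⁻¹
      left_inv := fun x => by rw [← h_mul, inv_mul_cancel, h_one]
      right_inv := fun x => by rw [← h_mul, mul_inv_cancel, h_one]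
      map_rel_iff' := (h_mono g).le_iff_le }
  map_one' := by ext x; exact h_one x
  map_mul' g h := by ext x; exact h_mul g h x

@[simp]
theorem orderActionOfStrictMono_apply {G X : Type*} [Group G] [LinearOrder X] (f : G → X → X)
    (h_one : ∀ x, f 1 x = x) (h_mul : ∀ g h x, f (g * h) x = f g (f h x))
    (h_mono : ∀ g, StrictMono (f g)) (g : G) (x : X) :
    orderActionOfStrictMono f h_one h_mul h_mono g x = f g x := rfl

/-- `s` occupies the same position relative to the image of `e` as `r` does relative to `ℚ`. -/
def IsRatExtensionAt (e : ℚ ≃o ℚ) (r s : ℝ) : Prop :=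
  (∀ q : ℚ, (q : ℝ) < r → (e q : ℝ) ≤ s) ∧ ∀ q : ℚ, r < q → s ≤ e q

theorem exists_isRatExtensionAt (e : ℚ ≃o ℚ) (r : ℝ) : ∃ s, IsRatExtensionAt e r s := by
  obtain ⟨q₀, hq₀⟩ := exists_rat_lt r
  obtain ⟨q₁, hq₁⟩ := exists_rat_gt r
  have h_le : ∀ q q' : ℚ, (q : ℝ) < r → r < q' → (e q : ℝ) ≤ e q' := fun q q' h h' => by
    have : q < q' := by exact_mod_cast h.trans h'
    exact_mod_cast e.monotone this.le
  refine ⟨sSup ((fun q : ℚ => (e q : ℝ)) '' {q | (q : ℝ) < r}), fun q hq => ?_, fun q hq => ?_⟩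
  · refine le_csSup ⟨e q₁, ?_⟩ ⟨q, hq, rfl⟩
    rintro _ ⟨q', hq', rfl⟩
    exact h_le q' q₁ hq' hq₁
  · refine csSup_le ⟨_, q₀, hq₀, rfl⟩ ?_
    rintro _ ⟨q', hq', rfl⟩
    exact h_le q' q hq' hq

theorem IsRatExtensionAt.lt_of_lt {e : ℚ ≃o ℚ} {r r' s s' : ℝ} (h : IsRatExtensionAt e r s)
    (h' : IsRatExtensionAt e r' s') (hr : r < r') : s < s' := by
  obtain ⟨q, hq, hq'⟩ := exists_rat_btwn hr
  obtain ⟨q₂, hq₂, hq₂'⟩ := exists_rat_btwn hq'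
  have h₁ := h.2 q hq
  have h₂ := h'.1 q₂ hq₂'
  have h₃ : (e q : ℝ) < e q₂ := by
    have : q < q₂ := by exact_mod_cast hq₂
    exact_mod_cast e.strictMono this
  linarith

theorem IsRatExtensionAt.unique {e : ℚ ≃o ℚ} {r s s' : ℝ} (h : IsRatExtensionAt e r s)
    (h' : IsRatExtensionAt e r s') : s = s' := by
  have key : ∀ {s s'}, IsRatExtensionAt e r s → IsRatExtensionAt e r s' → ¬ s < s' := by
    intro s s' h h' hlt
    obtain ⟨c, hc, hc'⟩ := exists_rat_btwn hlt
    obtain ⟨d, hd, hd'⟩ := exists_rat_btwn hc'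
    have hcd : e.symm c < e.symm d := e.symm.strictMono (by exact_mod_cast hd)
    rcases lt_or_ge r (e.symm d : ℝ) with hr | hr
    · have := h'.2 _ hr
      rw [e.apply_symm_apply] at this
      linarith
    · have hc₁ : ((e.symm c : ℚ) : ℝ) < r := lt_of_lt_of_le (by exact_mod_cast hcd) hr
      rcases lt_or_ge ((e.symm c : ℚ) : ℝ) r with hr' | hr'
      · have := h.1 _ hr'
        rw [e.apply_symm_apply] at this
        linarith
      · linarith
  exact le_antisymm (not_lt.1 (key h' h)) (not_lt.1 (key h h'))

/-- The extension to `ℝ` of an order automorphism of `ℚ`. -/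
noncomputable def ratExtension (e : ℚ ≃o ℚ) (r : ℝ) : ℝ := (exists_isRatExtensionAt e r).choose

theorem isRatExtensionAt_ratExtension (e : ℚ ≃o ℚ) (r : ℝ) :
    IsRatExtensionAt e r (ratExtension e r) := (exists_isRatExtensionAt e r).choose_spec

theorem ratExtension_ratCast (e : ℚ ≃o ℚ) (q : ℚ) : ratExtension e q = e q := by
  refine (isRatExtensionAt_ratExtension e q).unique ⟨fun q' h => ?_, fun q' h => ?_⟩
  · exact_mod_cast e.monotone (by exact_mod_cast h.le)
  · exact_mod_cast e.monotone (by exact_mod_cast h.le)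

theorem ratExtension_strictMono (e : ℚ ≃o ℚ) : StrictMono (ratExtension e) := fun r r' h =>
  (isRatExtensionAt_ratExtension e r).lt_of_lt (isRatExtensionAt_ratExtension e r') h

theorem ratExtension_one (r : ℝ) : ratExtension 1 r = r :=
  (isRatExtensionAt_ratExtension 1 r).unique ⟨fun _ h => h.le, fun _ h => h.le⟩

theorem ratExtension_mul (e f : ℚ ≃o ℚ) (r : ℝ) :
    ratExtension (e * f) r = ratExtension e (ratExtension f r) := by
  refine (isRatExtensionAt_ratExtension (e * f) r).unique ⟨fun q h => ?_, fun q h => ?_⟩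
  · have := (ratExtension_strictMono e).monotone ((isRatExtensionAt_ratExtension f r).1 q h)
    rwa [ratExtension_ratCast] at this
  · have := (ratExtension_strictMono e).monotone ((isRatExtensionAt_ratExtension f r).2 q h)
    rwa [ratExtension_ratCast] at this

/-- A point of a linearly ordered set on which a countable group acts can be realised in an action
on the real line, with the same stabiliser. -/
theorem exists_real_action_with_stabilizer {G X : Type*} [Group G] [Countable G] [LinearOrder X]
    (θ : G →* (X ≃o X)) (x : X) :
    ∃ (ρ : G →* (ℝ ≃o ℝ)) (ξ : ℝ), ∀ g, ρ g ξ = ξ ↔ θ g x = x := by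
  let Y := {y : X // ∃ g, θ g x = y}
  have : Countable Y :=
    Function.Surjective.countable (f := fun g : G => (⟨θ g x, g, rfl⟩ : Y)) (by
      rintro ⟨_, g, rfl⟩; exact ⟨g, rfl⟩)
  let y₀ : Y := ⟨x, 1, by simp⟩
  have : Nonempty Y := ⟨y₀⟩
  have : Countable (Y ×ₗ ℚ) := inferInstanceAs (Countable (Y × ℚ))
  have : Nonempty (Y ×ₗ ℚ) := inferInstanceAs (Nonempty (Y × ℚ))
  have : NoMinOrder (Y ×ₗ ℚ) := ⟨fun z => ⟨toLex ((ofLex z).1, (ofLex z).2 - 1), by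
    simp [Prod.Lex.lt_iff]⟩⟩
  have : NoMaxOrder (Y ×ₗ ℚ) := ⟨fun z => ⟨toLex ((ofLex z).1, (ofLex z).2 + 1), by
    simp [Prod.Lex.lt_iff]⟩⟩
  obtain ⟨e⟩ := Order.iso_of_countable_dense (Y ×ₗ ℚ) ℚ
  let φ : G → Y ×ₗ ℚ → Y ×ₗ ℚ := fun g z =>
    toLex (⟨θ g (ofLex z).1, by
      obtain ⟨h, hh⟩ := (ofLex z).1.2
      exact ⟨g * h, by rw [← hh, map_mul, RelIso.mul_apply]⟩⟩, (ofLex z).2)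
  let Φ : G →* ((Y ×ₗ ℚ) ≃o (Y ×ₗ ℚ)) := orderActionOfStrictMono φ
    (fun z => by simp [φ]) (fun g h z => by simp [φ, RelIso.mul_apply]) (fun g z w h => by
      rw [Prod.Lex.lt_iff] at h ⊢
      rcases h with h | ⟨h, h'⟩
      · exact Or.inl ((θ g).strictMono h)
      · exact Or.inr ⟨by simp only [φ, ofLex_toLex]; rw [h], h'⟩)
  let ψ : G → (ℚ ≃o ℚ) := fun g => (e.symm.trans (Φ g)).trans e
  refine ⟨orderActionOfStrictMono (fun g => ratExtension (ψ g)) (fun r => ?_) (fun g h r => ?_)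
    (fun g => ratExtension_strictMono _), (e (toLex (y₀, 0)) : ℚ), fun g => ?_⟩
  · have : ψ 1 = 1 := by ext q; simp [ψ]
    rw [this, ratExtension_one]
  · have : ψ (g * h) = ψ g * ψ h := by ext q; simp [ψ, RelIso.mul_apply]
    rw [this, ratExtension_mul]
  · rw [orderActionOfStrictMono_apply, ratExtension_ratCast]
    have h₁ : ψ g (e (toLex (y₀, 0))) = e (φ g (toLex (y₀, 0))) := by
      simp only [ψ, OrderIso.trans_apply, OrderIso.symm_apply_apply]; rfl
    rw [h₁, Rat.cast_inj, e.injective.eq_iff]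
    simp only [φ, ofLex_toLex, toLex_inj, Prod.mk.injEq, and_true, y₀]
    exact Subtype.mk_eq_mk

theorem IsRightOrderable.exists_real_action {H : Type*} [Group H] [Countable H]
    (hH : IsRightOrderable H) :
    ∃ (ρ : H →* (ℝ ≃o ℝ)) (ξ : ℝ), ∀ g, ρ g ξ = ξ → g = 1 := by
  classical
  obtain ⟨lt, hlt, h_mul⟩ := hH
  let _ : LinearOrder H := linearOrderOfSTO lt
  obtain ⟨ρ, ξ, h⟩ := exists_real_action_with_stabilizer
    (orderActionOfStrictMono (fun g x : H => x * g⁻¹) (by simp) (by simp [mul_assoc])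
      (fun g x y h => h_mul x y g⁻¹ h)) 1
  refine ⟨ρ, ξ, fun g hg => ?_⟩
  have h_fix : (1 : H) * g⁻¹ = 1 := (h g).1 hg
  simpa using h_fix

instance {A B : Type*} [Group A] [Group B] [Countable A] [Countable B] :
    Countable (Monoid.Coprod A B) :=
  have : Countable (FreeMonoid (A ⊕ B)) := inferInstanceAs (Countable (List (A ⊕ B)))
  Monoid.Coprod.mk_surjective.countable

/-- The element of `A ∗ B` given by a letter. -/
def letter {A B : Type*} [Group A] [Group B] : A ⊕ B → Monoid.Coprod A B :=
  Sum.elim Monoid.Coprod.inl Monoid.Coprod.inr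

/-- The product `L (k - 1) * ⋯ * L 1 * L 0`. -/
def walk {A B : Type*} [Group A] [Group B] (L : ℕ → A ⊕ B) : ℕ → Monoid.Coprod A B
  | 0 => 1
  | k + 1 => letter (L k) * walk L k

/-- A letter is nontrivial if it is not the identity of its factor. -/
def IsNontrivialLetter {A B : Type*} [Group A] [Group B] (s : A ⊕ B) : Prop :=
  s ≠ Sum.inl 1 ∧ s ≠ Sum.inr 1

section Walk

variable {A B : Type*} [Group A] [Group B]

theorem walk_add (L : ℕ → A ⊕ B) (i k : ℕ) :
    walk L (i + k) = walk (fun j => L (i + j)) k * walk L i := by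
  induction k with
  | zero => simp [walk]
  | succ k ih => rw [← add_assoc, walk, ih, walk, mul_assoc]

theorem walk_congr {L L' : ℕ → A ⊕ B} {K : ℕ} (h : ∀ k < K, L k = L' k) :
    walk L K = walk L' K := by
  induction K with
  | zero => rfl
  | succ K ih => rw [walk, walk, ih fun k hk => h k (by omega), h K (by omega)]

/-- Every element of `A ∗ B` is represented by a reduced word. -/
theorem exists_reduced_walk (g : Monoid.Coprod A B) :
    ∃ (K : ℕ) (L : ℕ → A ⊕ B), (∀ k < K, IsNontrivialLetter (L k)) ∧
      (∀ k, k + 1 < K → (L (k + 1)).isLeft ≠ (L k).isLeft) ∧ walk L K = g := by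
  have step : ∀ (s : A ⊕ B) (g : Monoid.Coprod A B),
      (∃ (K : ℕ) (L : ℕ → A ⊕ B), (∀ k < K, IsNontrivialLetter (L k)) ∧
        (∀ k, k + 1 < K → (L (k + 1)).isLeft ≠ (L k).isLeft) ∧ walk L K = g) →
      (∃ (K : ℕ) (L : ℕ → A ⊕ B), (∀ k < K, IsNontrivialLetter (L k)) ∧
        (∀ k, k + 1 < K → (L (k + 1)).isLeft ≠ (L k).isLeft) ∧ walk L K = letter s * g) := by
    rintro s _ ⟨K, L, h_nt, h_alt, rfl⟩
    by_cases hs : IsNontrivialLetter s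
    swap
    · refine ⟨K, L, h_nt, h_alt, ?_⟩
      have : letter s = 1 := by
        rw [IsNontrivialLetter, not_and_or, not_not, not_not] at hs
        rcases hs with rfl | rfl <;> simp [letter]
      rw [this, one_mul]
    have push : ∀ (K : ℕ) (s : A ⊕ B), IsNontrivialLetter s →
        (∀ k < K, IsNontrivialLetter (L k)) →
        (∀ k, k + 1 < K → (L (k + 1)).isLeft ≠ (L k).isLeft) →
        (∀ k, k + 1 = K → s.isLeft ≠ (L k).isLeft) →
        ∃ (K' : ℕ) (L' : ℕ → A ⊕ B), (∀ k < K', IsNontrivialLetter (L' k)) ∧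
          (∀ k, k + 1 < K' → (L' (k + 1)).isLeft ≠ (L' k).isLeft) ∧
          walk L' K' = letter s * walk L K := by
      intro K s hs h_nt h_alt h_last
      refine ⟨K + 1, fun k => if k = K then s else L k, fun k hk => ?_, fun k hk => ?_, ?_⟩
      · dsimp only
        split_ifs with h
        · exact hs
        · exact h_nt k (by omega)
      · dsimp only
        rw [if_neg (show k ≠ K by omega)]
        split_ifs with h
        · exact h_last k h
        · exact h_alt k (by omega)
      · rw [walk, walk_congr (L' := L) fun k hk => if_neg (by omega)]
        simp
    rcases K with _ | K
    · exact push 0 s hs h_nt h_alt (by omega)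
    by_cases h_side : s.isLeft = (L K).isLeft
    swap
    · refine push (K + 1) s hs h_nt h_alt fun k hk => ?_
      obtain rfl : k = K := by omega
      exact h_side
    have h_nt' : ∀ k < K, IsNontrivialLetter (L k) := fun k hk => h_nt k (by omega)
    have h_alt' : ∀ k, k + 1 < K → (L (k + 1)).isLeft ≠ (L k).isLeft :=
      fun k hk => h_alt k (by omega)
    obtain ⟨s', hs', h_mul⟩ : ∃ s' : A ⊕ B, s'.isLeft = (L K).isLeft ∧
        letter s' = letter s * letter (L K) := by
      rcases s with a | b <;> rcases hL : L K with a' | b' <;> rw [hL] at h_side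
      · exact ⟨.inl (a * a'), rfl, by simp [letter]⟩
      · simp at h_side
      · simp at h_side
      · exact ⟨.inr (b * b'), rfl, by simp [letter]⟩
    rw [walk, ← mul_assoc, ← h_mul]
    by_cases hs'_nt : IsNontrivialLetter s'
    · refine push K s' hs'_nt h_nt' h_alt' fun k hk => ?_
      subst hk
      rw [hs']
      exact h_alt k (by omega)
    · refine ⟨K, L, h_nt', h_alt', ?_⟩
      have : letter s' = 1 := by
        rw [IsNontrivialLetter, not_and_or, not_not, not_not] at hs'_nt
        rcases hs'_nt with rfl | rfl <;> simp [letter]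
      rw [this, one_mul]
  induction g using Monoid.Coprod.induction_on' with
  | one => exact ⟨0, fun _ => .inl 1, by simp, by simp, rfl⟩
  | inl_mul a x ih => exact step (.inl a) x ih
  | inr_mul b x ih => exact step (.inr b) x ih

end Walk

section Lift

variable {A B : Type*} [Group A] [Group B]

/-- The indicator of the letters coming from the left factor. -/
def leftInd (s : A ⊕ B) : ℝ := if s.isLeft then 1 else 0

/-- The shift, in units of `t`, picked up by `fiberOrbit` when passing from `k` to `k + 1`. -/
def jump (L : ℕ → A ⊕ B) (V : ℕ → Bool) (k : ℕ) : ℝ :=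
  if V (k + 1) then leftInd (L k) - leftInd (L (k + 1)) else 0

/-- The orbit of `o` under the letters of `L`, modified by a shift at each visit `V`. -/
def fiberOrbit (L : ℕ → A ⊕ B) (V : ℕ → Bool) (ρ : Monoid.Coprod A B →* (ℝ ≃o ℝ)) (t o : ℝ) :
    ℕ → ℝ
  | 0 => o
  | k + 1 => ρ (letter (L k)) (fiberOrbit L V ρ t o k) + t * jump L V k

/-- The fibre coordinate of the lifted orbit. -/
def fiberPoint (L : ℕ → A ⊕ B) (V : ℕ → Bool) (ρ : Monoid.Coprod A B →* (ℝ ≃o ℝ)) (t o : ℝ)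
    (k : ℕ) : ℝ :=
  fiberOrbit L V ρ t o k + t * if V k then leftInd (L k) else 0

/-- The action on `X ×ₗ ℝ` by a pair of actions on the factors. -/
noncomputable def lexAction {G X : Type*} [Group G] [LinearOrder X] (θ : G →* (X ≃o X))
    (ρ : G →* (ℝ ≃o ℝ)) :
    G →* ((X ×ₗ ℝ) ≃o (X ×ₗ ℝ)) :=
  orderActionOfStrictMono (fun g z => toLex (θ g (ofLex z).1, ρ g (ofLex z).2))
    (fun z => by simp) (fun g h z => by simp [RelIso.mul_apply]) (fun g z w h => by
      rw [Prod.Lex.lt_iff] at h ⊢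
      rcases h with h | ⟨h, h'⟩
      · exact Or.inl ((θ g).strictMono h)
      · exact Or.inr ⟨congrArg (θ g) h, (ρ g).strictMono h'⟩)

@[simp]
theorem lexAction_apply {G X : Type*} [Group G] [LinearOrder X] (θ : G →* (X ≃o X))
    (ρ : G →* (ℝ ≃o ℝ)) (g : G) (p : X) (y : ℝ) :
    lexAction θ ρ g (toLex (p, y)) = toLex (θ g p, ρ g y) := rfl

/-- Translation by `t` in the fibre over `q`. -/
def fiberShift {X : Type*} [LinearOrder X] (q : X) (t : ℝ) : (X ×ₗ ℝ) ≃o (X ×ₗ ℝ) where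
  toFun z := toLex ((ofLex z).1, (ofLex z).2 + if (ofLex z).1 = q then t else 0)
  invFun z := toLex ((ofLex z).1, (ofLex z).2 - if (ofLex z).1 = q then t else 0)
  left_inv z := by
    obtain ⟨⟨p, y⟩, rfl⟩ := toLex.surjective z
    exact congrArg toLex (Prod.ext rfl (add_sub_cancel_right y _))
  right_inv z := by
    obtain ⟨⟨p, y⟩, rfl⟩ := toLex.surjective z
    exact congrArg toLex (Prod.ext rfl (sub_add_cancel y _))
  map_rel_iff' {z w} := by
    obtain ⟨⟨p, y⟩, rfl⟩ := toLex.surjective z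
    obtain ⟨⟨p', y'⟩, rfl⟩ := toLex.surjective w
    simp only [Equiv.coe_fn_mk, Prod.Lex.le_iff, ofLex_toLex]
    refine or_congr_right (and_congr_right fun h => ?_)
    rw [h]
    exact add_le_add_iff_right _

@[simp]
theorem fiberShift_apply {X : Type*} [LinearOrder X] (q : X) (t : ℝ) (p : X) (y : ℝ) :
    fiberShift q t (toLex (p, y)) = toLex (p, y + if p = q then t else 0) := rfl

/-- The action on `X ×ₗ ℝ` in which the left factor is conjugated by `fiberShift q t`. -/
noncomputable def twistedAction {X : Type*} [LinearOrder X] (θ : Monoid.Coprod A B →* (X ≃o X))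
    (ρ : Monoid.Coprod A B →* (ℝ ≃o ℝ)) (q : X) (t : ℝ) :
    Monoid.Coprod A B →* ((X ×ₗ ℝ) ≃o (X ×ₗ ℝ)) :=
  Monoid.Coprod.lift
    ((MulAut.conj (fiberShift q t)).toMonoidHom.comp ((lexAction θ ρ).comp Monoid.Coprod.inl))
    ((lexAction θ ρ).comp Monoid.Coprod.inr)

theorem twistedAction_letter {X : Type*} [LinearOrder X] (θ : Monoid.Coprod A B →* (X ≃o X))
    (ρ : Monoid.Coprod A B →* (ℝ ≃o ℝ)) (q : X) (t : ℝ) (s : A ⊕ B) (p : X) (o : ℝ) :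
    twistedAction θ ρ q t (letter s) (toLex (p, o + t * if p = q then leftInd s else 0)) =
      toLex (θ (letter s) p, ρ (letter s) o + t * if θ (letter s) p = q then leftInd s else 0) := by
  rcases s with a | b
  · have h : (fiberShift q t)⁻¹ (toLex (p,
        o + t * if p = q then leftInd (Sum.inl a : A ⊕ B) else 0))
        = toLex (p, o) := by
      refine (fiberShift q t).injective ?_
      rw [RelIso.apply_inv_self]
      simp [leftInd]
    simp [twistedAction, letter, RelIso.mul_apply] at h ⊢
    rw [h]
    simp [leftInd]
  · simp [twistedAction, letter, leftInd]

theorem twistedAction_walk {X : Type*} [LinearOrder X] (θ : Monoid.Coprod A B →* (X ≃o X))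
    (ρ : Monoid.Coprod A B →* (ℝ ≃o ℝ)) (q : X) (t o : ℝ) (x : X) (L : ℕ → A ⊕ B)
    (V : ℕ → Bool) (hV : ∀ k, V k = true ↔ θ (walk L k) x = q) (k : ℕ) :
    twistedAction θ ρ q t (walk L k) (toLex (x, fiberPoint L V ρ t o 0)) =
      toLex (θ (walk L k) x, fiberPoint L V ρ t o k) := by
  induction k with
  | zero => simp [walk]
  | succ k ih =>
    rw [walk, map_mul, RelIso.mul_apply, ih, fiberPoint]
    simp only [hV]
    rw [twistedAction_letter, map_mul, RelIso.mul_apply, fiberPoint, fiberOrbit]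
    simp only [jump, hV, walk, map_mul, RelIso.mul_apply]
    congr 2
    split_ifs <;> ring

theorem fiberOrbit_of_forall_eq_false {L : ℕ → A ⊕ B} {V : ℕ → Bool}
    {ρ : Monoid.Coprod A B →* (ℝ ≃o ℝ)} {t o : ℝ} {K : ℕ}
    (h : ∀ k, 0 < k → k ≤ K → t = 0 ∨ V k = false) :
    fiberOrbit L V ρ t o K = ρ (walk L K) o := by
  induction K with
  | zero => simp [walk, fiberOrbit]
  | succ K ih =>
    rw [fiberOrbit, ih fun k hk hk' => h k hk (by omega), walk, map_mul, RelIso.mul_apply, jump]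
    rcases h (K + 1) (by omega) le_rfl with h | h <;> simp [h]

theorem exists_action_walk_injOn [Countable A] [Countable B]
    (hA : IsRightOrderable A) (hB : IsRightOrderable B) (K : ℕ) (L : ℕ → A ⊕ B)
    (h_nt : ∀ k < K, IsNontrivialLetter (L k))
    (h_alt : ∀ k, k + 1 < K → (L (k + 1)).isLeft ≠ (L k).isLeft) :
    ∃ (X : Type) (_ : LinearOrder X) (θ : Monoid.Coprod A B →* (X ≃o X)) (x : X),
      ∀ j, ∀ i < j, j ≤ K → θ (walk L i) x ≠ θ (walk L j) x := by
  induction K with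
  | zero => exact ⟨Unit, inferInstance, 1, (), by omega⟩
  | succ K ih =>
    obtain ⟨X, _, θ, x, h_inj, h_next⟩ : ∃ (X : Type) (_ : LinearOrder X)
        (θ : Monoid.Coprod A B →* (X ≃o X)) (x : X),
        (∀ j, ∀ i < j, j ≤ K → θ (walk L i) x ≠ θ (walk L j) x) ∧
        θ (walk L K) x ≠ θ (walk L (K + 1)) x := by
      obtain ⟨X, _, θ, x, h⟩ := ih (fun k hk => h_nt k (by omega)) fun k hk => h_alt k (by omega)
      obtain ⟨ρ, ξ, h_move⟩ : ∃ (ρ : Monoid.Coprod A B →* (ℝ ≃o ℝ)) (ξ : ℝ),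
          ρ (letter (L K)) ξ ≠ ξ := by
        have h_nt := h_nt K (by omega)
        rcases hL : L K with a | b <;> rw [hL] at h_nt
        · obtain ⟨α, ξ, hα⟩ := hA.exists_real_action
          exact ⟨Monoid.Coprod.lift α 1, ξ, fun h => h_nt.1
            (by rw [hα a (by simpa [letter] using h)])⟩
        · obtain ⟨β, ξ, hβ⟩ := hB.exists_real_action
          exact ⟨Monoid.Coprod.lift 1 β, ξ, fun h => h_nt.2
            (by rw [hβ b (by simpa [letter] using h)])⟩
      refine ⟨X ×ₗ ℝ, inferInstance, lexAction θ ρ, toLex (x, (ρ (walk L K))⁻¹ ξ),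
        fun j i hi hj h_eq => h j i hi hj ?_, fun h_eq => h_move ?_⟩
      · simpa using congrArg (fun z => (ofLex z).1) h_eq
      · have := congrArg (fun z => (ofLex z).2) h_eq
        simp only [lexAction_apply, ofLex_toLex, walk, map_mul, RelIso.mul_apply,
          RelIso.apply_inv_self] at this
        exact this.symm
    classical
    let V : ℕ → Bool := fun k => θ (walk L k) x = θ (walk L K) x
    have hV : ∀ k, V k = true ↔ θ (walk L k) x = θ (walk L K) x := by simp [V]
    have hV_lt : ∀ k < K, V k = false := fun k hk => by
      simpa [V] using h_inj K k hk le_rfl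
    have hV_succ : V (K + 1) = false := by simpa [V] using h_next.symm
    refine ⟨X ×ₗ ℝ, inferInstance, twistedAction θ 1 (θ (walk L K) x) 1,
      toLex (x, fiberPoint L V 1 1 0 0), fun j i hi hj => ?_⟩
    rw [twistedAction_walk _ _ _ _ _ _ _ _ hV, twistedAction_walk _ _ _ _ _ _ _ _ hV]
    intro h_eq
    obtain ⟨h_fst, h_snd⟩ := Prod.mk.inj (toLex.injective h_eq)
    rcases Nat.lt_or_ge j (K + 1) with hj' | hj'
    · exact h_inj j i hi (by omega) h_fst
    obtain rfl : j = K + 1 := by omega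
    rcases Nat.lt_or_ge i K with hi' | hi'
    swap
    · obtain rfl : i = K := by omega
      exact h_next h_fst
    obtain ⟨K, rfl⟩ : ∃ K', K = K' + 1 := ⟨K - 1, by omega⟩
    have h_orbit : ∀ k < K + 1, fiberOrbit L V 1 1 0 k = 0 := fun k hk => by
      rw [fiberOrbit_of_forall_eq_false fun l _ hl => Or.inr (hV_lt l (by omega))]
      simp
    have h_alt := h_alt K (by omega)
    have hV_self : V (K + 1) = true := (hV _).2 rfl
    rw [fiberPoint, h_orbit i hi', hV_lt i hi', fiberPoint, hV_succ, fiberOrbit, fiberOrbit,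
      h_orbit K (by omega), jump, jump, hV_succ, hV_self] at h_snd
    cases h₀ : (L K).isLeft <;> cases h₁ : (L (K + 1)).isLeft <;> simp_all [leftInd]

theorem exists_real_action_apply_ne [Countable A] [Countable B]
    (hA : IsRightOrderable A) (hB : IsRightOrderable B) {g : Monoid.Coprod A B} (hg : g ≠ 1) :
    ∃ (ρ : Monoid.Coprod A B →* (ℝ ≃o ℝ)) (ξ : ℝ), ρ g ξ ≠ ξ := by
  obtain ⟨K, L, h_nt, h_alt, rfl⟩ := exists_reduced_walk g
  obtain ⟨X, _, θ, x, h⟩ := exists_action_walk_injOn hA hB K L h_nt h_alt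
  obtain ⟨ρ, ξ, hρ⟩ := exists_real_action_with_stabilizer θ x
  refine ⟨ρ, ξ, fun h_fix => ?_⟩
  have hK : 0 < K := by
    rcases Nat.eq_zero_or_pos K with rfl | hK
    · exact absurd rfl hg
    · exact hK
  refine h K 0 hK le_rfl ?_
  rw [(hρ _).1 h_fix]
  simp [walk]

theorem walk_ne_walk [Countable A] [Countable B]
    (hA : IsRightOrderable A) (hB : IsRightOrderable B) {L : ℕ → A ⊕ B}
    (h_nt : ∀ k, IsNontrivialLetter (L k)) (h_alt : ∀ k, (L (k + 1)).isLeft ≠ (L k).isLeft)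
    {k l : ℕ} (h : k < l) : walk L k ≠ walk L l := by
  obtain ⟨X, _, θ, x, hx⟩ :=
    exists_action_walk_injOn hA hB l L (fun k _ => h_nt k) fun k _ => h_alt k
  exact fun h_eq => hx l k h le_rfl (by rw [h_eq])

end Lift

section Local

/-- An action on the line can be compressed to one supported in the interval `(-1, 1)`. -/
theorem exists_compressed_action {G : Type*} [Group G] (ρ : G →* (ℝ ≃o ℝ)) :
    ∃ (σ : G →* (ℝ ≃o ℝ)) (e : ℝ → ℝ), StrictMono e ∧ (∀ x, e x ∈ Set.Ioo (-1) 1) ∧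
      (∀ g x, σ g (e x) = e (ρ g x)) ∧ ∀ g x, x ∉ Set.Ioo (-1 : ℝ) 1 → σ g x = x := by
  classical
  let e : ℝ ≃o Set.Ioo (-1 : ℝ) 1 := orderIsoIooNegOneOne ℝ
  let f : G → ℝ → ℝ := fun g x => if h : x ∈ Set.Ioo (-1 : ℝ) 1 then e (ρ g (e.symm ⟨x, h⟩)) else x
  have f_apply : ∀ g x, f g (e x) = e (ρ g x) := fun g x => by
    simp only [f, Subtype.coe_prop, dite_true, Subtype.coe_eta, OrderIso.symm_apply_apply]
  have f_of_notMem : ∀ g x, x ∉ Set.Ioo (-1 : ℝ) 1 → f g x = x := fun g x h => dif_neg h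
  have cases : ∀ x, x ∉ Set.Ioo (-1 : ℝ) 1 ∨ ∃ y, (e y : ℝ) = x := fun x => by
    by_cases h : x ∈ Set.Ioo (-1 : ℝ) 1
    · exact Or.inr ⟨e.symm ⟨x, h⟩, by simp⟩
    · exact Or.inl h
  refine ⟨orderActionOfStrictMono f (fun x => ?_) (fun g h x => ?_) (fun g x y hxy => ?_),
    fun x => e x, fun x y h => e.strictMono h, fun x => (e x).2, f_apply, f_of_notMem⟩
  · rcases cases x with h | ⟨y, rfl⟩
    · exact f_of_notMem 1 x h
    · rw [f_apply, map_one, RelIso.one_apply]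
  · rcases cases x with hx | ⟨y, rfl⟩
    · simp only [f_of_notMem _ x hx]
    · simp only [f_apply, map_mul, RelIso.mul_apply]
  · rcases cases x with hx | ⟨x, rfl⟩ <;> rcases cases y with hy | ⟨y, rfl⟩
    · rwa [f_of_notMem _ _ hx, f_of_notMem _ _ hy]
    · rw [f_of_notMem _ _ hx, f_apply]
      have h₁ := (e y).2
      have h₂ := (e (ρ g y)).2
      simp only [Set.mem_Ioo, not_and, not_lt] at hx h₁ h₂
      by_contra h
      exact absurd (hx (by linarith)) (by linarith)
    · rw [f_of_notMem _ _ hy, f_apply]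
      have h₁ := (e x).2
      have h₂ := (e (ρ g x)).2
      simp only [Set.mem_Ioo, not_and, not_lt] at hy h₁ h₂
      linarith [hy (by linarith)]
    · rw [f_apply, f_apply]
      exact e.strictMono ((ρ g).strictMono (e.lt_iff_lt.1 hxy))

theorem exists_lt_apply_of_apply_ne {G : Type*} [Group G] {g : G}
    (h : ∃ (ρ : G →* (ℝ ≃o ℝ)) (ξ : ℝ), ρ g ξ ≠ ξ) : ∃ (ρ : G →* (ℝ ≃o ℝ)) (ξ : ℝ), ξ < ρ g ξ := by
  obtain ⟨ρ, ξ, h⟩ := h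
  rcases h.lt_or_gt with h | h
  · exact ⟨orderActionOfStrictMono (fun g x => -ρ g (-x)) (by simp)
      (by simp [RelIso.mul_apply]) (fun g x y h => by simpa using h), -ξ,
      show -ξ < -ρ g (- -ξ) by simpa using h⟩
  · exact ⟨ρ, ξ, h⟩

/-- Two elements acting nontrivially on the line admit a common action on the line with bounded
displacement, trivial far to the left, in which the first moves a point up and the second moves a
point down. -/
theorem exists_local_action {G : Type*} [Group G] {g₁ g₂ : G}
    (h₁ : ∃ (ρ : G →* (ℝ ≃o ℝ)) (ξ : ℝ), ρ g₁ ξ ≠ ξ)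
    (h₂ : ∃ (ρ : G →* (ℝ ≃o ℝ)) (ξ : ℝ), ρ g₂ ξ ≠ ξ) :
    ∃ (ρ : G →* (ℝ ≃o ℝ)) (ξ η : ℝ), (∀ g x, |ρ g x - x| < 2) ∧ (∀ g x, x < -1 → ρ g x = x) ∧
      ξ < ρ g₁ ξ ∧ ρ g₂ η < η := by
  classical
  obtain ⟨ρ₁, ξ, h₁⟩ := exists_lt_apply_of_apply_ne h₁
  obtain ⟨ρ₂, η, h₂⟩ := exists_lt_apply_of_apply_ne (g := g₂⁻¹) <| by
    obtain ⟨ρ, ξ, h⟩ := h₂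
    refine ⟨ρ, ξ, fun h' => h ?_⟩
    conv_lhs => rw [← h', map_inv]
    simp
  obtain ⟨σ₁, e₁, he₁, he₁_mem, hσ₁, hσ₁'⟩ := exists_compressed_action ρ₁
  obtain ⟨σ₂, e₂, he₂, he₂_mem, hσ₂, hσ₂'⟩ := exists_compressed_action ρ₂
  have σ_mem : ∀ (σ : G →* (ℝ ≃o ℝ)), (∀ g x, x ∉ Set.Ioo (-1 : ℝ) 1 → σ g x = x) →
      ∀ g x, (x < -1 → σ g x = x) ∧ (1 < x → σ g x = x) ∧ |σ g x - x| < 2 := by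
    intro σ hσ g x
    refine ⟨fun h => hσ g x fun h' => by linarith [h'.1],
      fun h => hσ g x fun h' => by linarith [h'.2], ?_⟩
    by_cases hx : x ∈ Set.Ioo (-1 : ℝ) 1
    · have h₁ := (σ g).strictMono hx.1
      have h₂ := (σ g).strictMono hx.2
      rw [hσ _ (-1) (by simp)] at h₁
      rw [hσ _ 1 (by simp)] at h₂
      rw [abs_lt]
      constructor <;> linarith [hx.1, hx.2]
    · rw [hσ g x hx]
      simp
  have B₁ := σ_mem σ₁ hσ₁'
  have B₂ := σ_mem σ₂ hσ₂'
  have σ₁_lt : ∀ g x, σ₁ g x < 2 ↔ x < 2 := fun g x => by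
    rw [← (σ₁ g).lt_iff_lt (x := x) (y := 2), (B₁ g 2).2.1 (by norm_num)]
  have σ₂_lt : ∀ g x, 4 + σ₂ g (x - 4) < 2 ↔ x < 2 := fun g x => by
    have := (σ₂ g).lt_iff_lt (x := x - 4) (y := -2)
    rw [(B₂ g (-2)).1 (by norm_num)] at this
    constructor <;> intro h
    · linarith [this.1 (by linarith)]
    · linarith [this.2 (by linarith)]
  obtain ⟨σ, hσ⟩ : ∃ σ : G →* (ℝ ≃o ℝ), ∀ g x, σ g x = if x < 2 then σ₁ g x
      else 4 + σ₂ g (x - 4) := by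
    refine ⟨orderActionOfStrictMono (fun g x => if x < 2 then σ₁ g x else 4 + σ₂ g (x - 4))
      (fun x => by simp) (fun g h x => ?_) (fun g x y hxy => ?_), fun _ _ => rfl⟩
    · by_cases hx : x < 2
      · simp [hx, σ₁_lt, RelIso.mul_apply]
      · simp [hx, σ₂_lt, RelIso.mul_apply]
    · have h₁ := σ₁_lt g x
      have h₂ := σ₂_lt g y
      have h₃ := (σ₁ g).strictMono hxy
      have h₄ := (σ₂ g).strictMono (sub_lt_sub_right hxy 4)
      dsimp only
      split_ifs with hx hy hy
      · exact h₃
      · have := h₁.2 hx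
        have := mt h₂.1 hy
        linarith
      · linarith
      · linarith
  refine ⟨σ, e₁ ξ, 4 + e₂ η, fun g x => ?_, fun g x hx => ?_, ?_, ?_⟩
  · rw [hσ]
    split_ifs
    · exact (B₁ g x).2.2
    · have := (B₂ g (x - 4)).2.2
      rwa [show 4 + σ₂ g (x - 4) - x = σ₂ g (x - 4) - (x - 4) by ring]
  · rw [hσ, if_pos (by linarith)]
    exact (B₁ g x).1 hx
  · rw [hσ, if_pos (by linarith [(he₁_mem ξ).2]), hσ₁]
    exact he₁ h₁
  · rw [hσ, if_neg (by linarith [(he₂_mem η).1]), add_sub_cancel_left,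
      hσ₂, add_lt_add_iff_left]
    refine he₂ ?_
    have := (ρ₂ g₂).strictMono h₂
    rwa [map_inv, RelIso.apply_inv_self] at this

end Local

section Split

variable {A B : Type*} [Group A] [Group B]

theorem jump_of_alternating {A B : Type*} {L : ℕ → A ⊕ B}
    (h_alt : ∀ k, (L (k + 1)).isLeft ≠ (L k).isLeft)
    (V : ℕ → Bool) (k : ℕ) :
    jump L V k = if V (k + 1) then (if (L (k + 1)).isLeft then -1 else 1) else 0 := by
  have h := h_alt k
  rw [jump, leftInd, leftInd]
  cases h₁ : (L k).isLeft <;> cases h₂ : (L (k + 1)).isLeft <;> simp [h₁, h₂] at h ⊢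

theorem fiberOrbit_add (L : ℕ → A ⊕ B) (V : ℕ → Bool) (ρ : Monoid.Coprod A B →* (ℝ ≃o ℝ))
    (t o : ℝ) (i k : ℕ) :
    fiberOrbit L V ρ t o (i + k) =
      fiberOrbit (fun j => L (i + j)) (fun j => V (i + j)) ρ t (fiberOrbit L V ρ t o i) k := by
  induction k with
  | zero => rfl
  | succ k ih => rw [← add_assoc, fiberOrbit, ih, fiberOrbit]; rfl

theorem fiberOrbit_of_no_visit_between {L : ℕ → A ⊕ B} {V : ℕ → Bool}
    (ρ : Monoid.Coprod A B →* (ℝ ≃o ℝ)) (t o : ℝ) {k l : ℕ} (hkl : k < l)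
    (h : ∀ i, k < i → i < l → V i = false) :
    fiberOrbit L V ρ t o l = ρ (walk (fun j => L (k + j)) (l - k)) (fiberOrbit L V ρ t o k) +
      t * jump L V (l - 1) := by
  obtain ⟨d, rfl⟩ : ∃ d, l = k + d + 1 := ⟨l - k - 1, by omega⟩
  rw [show k + d + 1 - k = d + 1 by omega, add_tsub_cancel_right, walk, fiberOrbit, fiberOrbit_add,
    fiberOrbit_of_forall_eq_false fun i hi hi' => Or.inr (h (k + i) (by omega) (by omega)),
    map_mul, RelIso.mul_apply]

theorem continuous_fiberOrbit (L : ℕ → A ⊕ B) (V : ℕ → Bool) (ρ : Monoid.Coprod A B →* (ℝ ≃o ℝ))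
    {t o : ℝ → ℝ} (ht : Continuous t) (ho : Continuous o) (k : ℕ) :
    Continuous fun s => fiberOrbit L V ρ (t s) (o s) k := by
  induction k with
  | zero => exact ho
  | succ k ih => exact ((ρ _).continuous.comp ih).add (ht.mul continuous_const)

theorem abs_fiberOrbit_sub_le (L : ℕ → A ⊕ B) (V : ℕ → Bool)
    {ρ : Monoid.Coprod A B →* (ℝ ≃o ℝ)} (hρ : ∀ g x, |ρ g x - x| < 2) (t o : ℝ) (k : ℕ) :
    |fiberOrbit L V ρ t o k - o - t * ∑ j ∈ Finset.range k, jump L V j| ≤ 2 * k := by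
  induction k with
  | zero => simp [fiberOrbit]
  | succ k ih =>
    have := hρ (letter (L k)) (fiberOrbit L V ρ t o k)
    rw [Finset.sum_range_succ, fiberOrbit]
    push_cast
    rw [abs_le] at ih ⊢
    rw [abs_lt] at this
    constructor <;> linarith

theorem exists_fiberOrbit_eq_of_sum_jump_ne_zero {L : ℕ → A ⊕ B} {V : ℕ → Bool} {N : ℕ}
    (hS : ∑ j ∈ Finset.range N, jump L V j ≠ 0)
    {ρ : Monoid.Coprod A B →* (ℝ ≃o ℝ)} (hρ : ∀ g x, |ρ g x - x| < 2) (o : ℝ) :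
    ∃ t, fiberOrbit L V ρ t o N = o := by
  set S := ∑ j ∈ Finset.range N, jump L V j with hS_def
  refine mem_range_of_exists_le_of_exists_ge
    (continuous_fiberOrbit L V ρ continuous_id continuous_const N) ⟨-(2 * N) / S, ?_⟩
    ⟨2 * N / S, ?_⟩
  · have := abs_fiberOrbit_sub_le L V hρ (-(2 * N) / S) o N
    rw [← hS_def, div_mul_cancel₀ _ hS, abs_le] at this
    linarith
  · have := abs_fiberOrbit_sub_le L V hρ (2 * N / S) o N
    rw [← hS_def, div_mul_cancel₀ _ hS, abs_le] at this
    linarith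

/-- Some lift closes up after `N` steps and separates two visits. -/
def Splits (L : ℕ → A ⊕ B) (V : ℕ → Bool) (N : ℕ) : Prop :=
  ∃ (ρ : Monoid.Coprod A B →* (ℝ ≃o ℝ)) (t o : ℝ), fiberOrbit L V ρ t o N = o ∧
    ∃ k, V k = true ∧ fiberPoint L V ρ t o k ≠ fiberPoint L V ρ t o 0

theorem fiberOrbit_eq_of_not_splits {L : ℕ → A ⊕ B} {V : ℕ → Bool} {N : ℕ} (h : ¬ Splits L V N)
    (hV : V 0 = true) {ρ : Monoid.Coprod A B →* (ℝ ≃o ℝ)} {t o : ℝ}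
    (h_closed : fiberOrbit L V ρ t o N = o) {k : ℕ} (hk : V k = true) :
    fiberOrbit L V ρ t o k = o + t * (leftInd (L 0) - leftInd (L k)) := by
  by_contra h_ne
  refine h ⟨ρ, t, o, h_closed, k, hk, fun h_eq => h_ne ?_⟩
  simp only [fiberPoint, hk, hV, fiberOrbit, if_true] at h_eq
  linarith

theorem apply_walk_eq_of_not_splits {L : ℕ → A ⊕ B} {V : ℕ → Bool} {N : ℕ} (h : ¬ Splits L V N)
    (h_alt : ∀ k, (L (k + 1)).isLeft ≠ (L k).isLeft)
    (hV : V 0 = true) {ρ : Monoid.Coprod A B →* (ℝ ≃o ℝ)} {t o : ℝ}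
    (h_closed : fiberOrbit L V ρ t o N = o) {k l : ℕ} (hk : V k = true) (hl : V l = true)
    (hkl : k < l) (h_between : ∀ i, k < i → i < l → V i = false)
    (h_side : (L l).isLeft ≠ (L k).isLeft) :
    ρ (walk (fun j => L (k + j)) (l - k)) (fiberOrbit L V ρ t o k) = fiberOrbit L V ρ t o k := by
  have h₁ := fiberOrbit_eq_of_not_splits h hV h_closed hk
  have h₂ := fiberOrbit_eq_of_not_splits h hV h_closed hl
  have h₃ := fiberOrbit_of_no_visit_between (L := L) ρ t o hkl h_between
  obtain ⟨m, rfl⟩ : ∃ m, l = m + 1 := ⟨l - 1, by omega⟩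
  have h₄ : jump L V m = leftInd (L k) - leftInd (L (m + 1)) := by
    rw [jump, if_pos hl]
    have := h_alt m
    simp only [leftInd]
    cases h₅ : (L m).isLeft <;> cases h₆ : (L (m + 1)).isLeft <;> cases h₇ : (L k).isLeft <;>
      simp_all
  rw [add_tsub_cancel_right, h₄] at h₃
  linear_combination h₂ - h₁ - h₃

/-- The last visit before a given time. -/
theorem exists_last_visit {V : ℕ → Bool} (hV : V 0 = true) {k : ℕ} (hk : 0 < k) :
    ∃ j < k, V j = true ∧ ∀ i, j < i → i < k → V i = false := by
  refine ⟨Nat.findGreatest (fun j => V j = true) (k - 1),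
    lt_of_le_of_lt (Nat.findGreatest_le _) (by omega),
    Nat.findGreatest_spec (P := fun j => V j = true) (Nat.zero_le _) hV, fun i hi hi' => ?_⟩
  simpa using Nat.findGreatest_is_greatest hi (by omega)

/-- The next visit after a given time. -/
theorem exists_next_visit {V : ℕ → Bool} {k : ℕ} (hk : ∃ l > k, V l = true) :
    ∃ l > k, V l = true ∧ ∀ i, k < i → i < l → V i = false := by
  classical
  refine ⟨Nat.find hk, (Nat.find_spec hk).1, (Nat.find_spec hk).2, fun i hi hi' => ?_⟩
  have := Nat.find_min hk hi'
  simpa [hi] using this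

theorem exists_local_action_coprod [Countable A] [Countable B]
    (hA : IsRightOrderable A) (hB : IsRightOrderable B) {g₁ g₂ : Monoid.Coprod A B}
    (h₁ : g₁ ≠ 1) (h₂ : g₂ ≠ 1) :
    ∃ (ρ : Monoid.Coprod A B →* (ℝ ≃o ℝ)) (ξ η : ℝ), (∀ g x, |ρ g x - x| < 2) ∧
      (∀ g x, x < -1 → ρ g x = x) ∧ ξ < ρ g₁ ξ ∧ ρ g₂ η < η :=
  exists_local_action (exists_real_action_apply_ne hA hB h₁) (exists_real_action_apply_ne hA hB h₂)

theorem splits_of_forall_isLeft_eq [Countable A] [Countable B]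
    (hA : IsRightOrderable A) (hB : IsRightOrderable B) {L : ℕ → A ⊕ B} {V : ℕ → Bool} {N : ℕ}
    (h_alt : ∀ k, (L (k + 1)).isLeft ≠ (L k).isLeft) (hN : V N = true)
    (hpow : ∀ (v : Monoid.Coprod A B) (j : ℕ), 2 ≤ j → walk L N ≠ v ^ j) (hV : V 0 = true)
    {d : ℕ} (hd : 0 < d) (hdN : d < N) (hd_visit : V d = true)
    (h_side : ∀ k, V k = true → (L k).isLeft = (L 0).isLeft) : Splits L V N := by
  by_contra h_not
  set ε : ℝ := if (L 0).isLeft then -1 else 1 with hε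
  have h_jump : ∀ k, V (k + 1) = true → jump L V k = ε := fun k hk => by
    rw [jump_of_alternating h_alt, if_pos hk, h_side _ hk]
  have hε_sq : ε * ε = 1 := by rw [hε]; split_ifs <;> norm_num
  have hS : ∑ j ∈ Finset.range N, jump L V j ≠ 0 := by
    intro hS
    have h_nonneg : ∀ j ∈ Finset.range N, 0 ≤ ε * jump L V j := fun j _ => by
      by_cases hj : V (j + 1) = true
      · rw [h_jump j hj, hε_sq]
        exact zero_le_one
      · simp [jump, hj]
    have h_le := Finset.single_le_sum h_nonneg (Finset.mem_range.2 (show N - 1 < N by omega))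
    rw [h_jump (N - 1) (by rwa [show N - 1 + 1 = N by omega]), hε_sq, ← Finset.mul_sum, hS] at h_le
    norm_num at h_le
  obtain ⟨l, hl, hl_visit, hl_between⟩ := exists_next_visit ⟨d, hd, hd_visit⟩
  by_cases h_all : ∀ k m, k < m → V k = true → V m = true → (∀ i, k < i → i < m → V i = false) →
      walk (fun j => L (k + j)) (m - k) = walk L l
  · have h_walk : ∀ k m, k < m → V k = true → V m = true → (∀ i, k < i → i < m → V i = false) →
        walk L m = walk L l * walk L k := fun k m hkm hk hm h_between => by
      rw [← h_all k m hkm hk hm h_between, ← walk_add, show k + (m - k) = m by omega]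
    have h_exp : ∀ k, 0 < k → V k = true → ∃ r, 1 ≤ r ∧ walk L k = walk L l ^ r := by
      intro k
      induction k using Nat.strong_induction_on with
      | _ k ih =>
        intro hk hk_visit
        obtain ⟨j, hj, hj_visit, hj_between⟩ := exists_last_visit hV hk
        rcases Nat.eq_zero_or_pos j with rfl | hj0
        · exact ⟨1, le_rfl, by rw [h_walk 0 k hj hV hk_visit hj_between]; simp [walk]⟩
        · obtain ⟨r, hr, hr'⟩ := ih j hj hj0 hj_visit
          exact ⟨r + 1, by omega, by
            rw [h_walk j k hj hj_visit hk_visit hj_between, hr', pow_succ']⟩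
    obtain ⟨j, hj, hj_visit, hj_between⟩ := exists_last_visit hV (show 0 < N by omega)
    have hj0 : 0 < j := by
      by_contra hj0
      rw [hj_between d (by omega) hdN] at hd_visit
      exact Bool.noConfusion hd_visit
    obtain ⟨r, hr, hr'⟩ := h_exp j hj0 hj_visit
    exact hpow (walk L l) (r + 1) (by omega) (by
      rw [h_walk j N hj hj_visit hN hj_between, hr', pow_succ'])
  · push Not at h_all
    obtain ⟨k, m, hkm, hk, hm, h_between, h_ne⟩ := h_all
    set v := walk (fun j => L (k + j)) (m - k) with hv
    have h_ne' : v⁻¹ * walk L l ≠ 1 := fun h => h_ne (inv_mul_eq_one.1 h)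
    obtain ⟨ρ, ξ, -, hρ, -, hξ, -⟩ := exists_local_action_coprod hA hB h_ne' h_ne'
    obtain ⟨t, ht⟩ := exists_fiberOrbit_eq_of_sum_jump_ne_zero hS hρ ξ
    have h_orbit : ∀ i, V i = true → fiberOrbit L V ρ t ξ i = ξ := fun i hi => by
      rw [fiberOrbit_eq_of_not_splits h_not hV ht hi, leftInd, leftInd, h_side i hi]
      simp
    have h₁ := fiberOrbit_of_no_visit_between (L := L) ρ t ξ hl hl_between
    have h₂ := fiberOrbit_of_no_visit_between (L := L) ρ t ξ hkm h_between
    rw [h_orbit _ hl_visit, h_orbit 0 hV,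
      h_jump _ (by rwa [show l - 1 + 1 = l by omega])] at h₁
    rw [h_orbit _ hm, h_orbit k hk, h_jump _ (by rwa [show m - 1 + 1 = m by omega]), ← hv] at h₂
    simp only [zero_add, Nat.sub_zero] at h₁
    have h₃ : ρ (walk L l) ξ = ρ v ξ := by linarith
    rw [map_mul, RelIso.mul_apply, h₃, map_inv, RelIso.inv_apply_self] at hξ
    exact lt_irrefl _ hξ

/-- The side of the most recent visit. -/
def lastSide (L : ℕ → A ⊕ B) (V : ℕ → Bool) : ℕ → Bool
  | 0 => (L 0).isLeft
  | k + 1 => if V (k + 1) then (L (k + 1)).isLeft else lastSide L V k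

theorem lastSide_of_visit {A B : Type*} {L : ℕ → A ⊕ B} {V : ℕ → Bool} {k : ℕ}
    (hk : V k = true) :
    lastSide L V k = (L k).isLeft := by
  cases k with
  | zero => rfl
  | succ k => rw [lastSide, if_pos hk]

theorem lastSide_of_no_visit_between {A B : Type*} {L : ℕ → A ⊕ B} {V : ℕ → Bool} {k l : ℕ}
    (hk : V k = true) (hkl : k ≤ l) (h : ∀ i, k < i → i ≤ l → V i = false) :
    lastSide L V l = (L k).isLeft := by
  induction l, hkl using Nat.le_induction with
  | base => exact lastSide_of_visit hk
  | succ l hkl ih =>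
    rw [lastSide, h (l + 1) (by omega) le_rfl]
    exact ih fun i hi hi' => h i hi (by omega)

/-- The product of the letters read while the most recent visit is on the side `b`. -/
def sideWalk (L : ℕ → A ⊕ B) (V : ℕ → Bool) (b : Bool) : ℕ → Monoid.Coprod A B
  | 0 => 1
  | k + 1 => if lastSide L V k = b then letter (L k) * sideWalk L V b k else sideWalk L V b k

theorem fiberOrbit_one (L : ℕ → A ⊕ B) (V : ℕ → Bool) (t o : ℝ) (k : ℕ) :
    fiberOrbit L V 1 t o k = o + t * ∑ j ∈ Finset.range k, jump L V j := by
  induction k with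
  | zero => simp [fiberOrbit]
  | succ k ih =>
    rw [fiberOrbit, ih, Finset.sum_range_succ, MonoidHom.one_apply, RelIso.one_apply]
    ring

theorem splits_of_lastSide_eq {L : ℕ → A ⊕ B} {V : ℕ → Bool} {N : ℕ}
    (h_alt : ∀ k, (L (k + 1)).isLeft ≠ (L k).isLeft) (hV : V 0 = true)
    (hS : ∑ j ∈ Finset.range N, jump L V j = 0) {k : ℕ} (hk : V (k + 1) = true)
    (h_side : (L (k + 1)).isLeft = lastSide L V k) : Splits L V N := by
  by_contra h_not
  have h_closed : fiberOrbit L V 1 1 0 N = 0 := by rw [fiberOrbit_one, hS]; simp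
  have h_visit : ∀ k, V k = true → fiberOrbit L V 1 1 0 k =
      leftInd (L 0) - if lastSide L V k then 1 else 0 := fun k hk => by
    rw [fiberOrbit_eq_of_not_splits h_not hV h_closed hk, lastSide_of_visit hk, zero_add, one_mul]
    rfl
  have h_orbit : ∀ k, fiberOrbit L V 1 1 0 k =
      leftInd (L 0) - if lastSide L V k then 1 else 0 := by
    intro k
    induction k with
    | zero => exact h_visit 0 hV
    | succ k ih =>
      by_cases hk : V (k + 1) = true
      · exact h_visit _ hk
      · rw [fiberOrbit, ih, lastSide, if_neg hk, jump, if_neg hk]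
        simp
  have h₁ := h_orbit (k + 1)
  rw [fiberOrbit, h_orbit k, lastSide_of_visit hk, h_side, jump_of_alternating h_alt, if_pos hk]
    at h₁
  simp only [MonoidHom.one_apply, RelIso.one_apply, one_mul] at h₁
  split_ifs at h₁ <;> linarith

section Alternating

variable {L : ℕ → A ⊕ B} {V : ℕ → Bool}

theorem mul_jump {A B : Type*} {L : ℕ → A ⊕ B} {V : ℕ → Bool}
    (h_alt : ∀ k, (L (k + 1)).isLeft ≠ (L k).isLeft)
    (h_last : ∀ k, V (k + 1) = true → (L (k + 1)).isLeft = !lastSide L V k)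
    (c : Bool → ℝ) (k : ℕ) :
    (c false - c true) * jump L V k =
      if V (k + 1) then c (!lastSide L V k) - c (lastSide L V k) else 0 := by
  rw [jump_of_alternating h_alt]
  by_cases hk : V (k + 1) = true
  · rw [if_pos hk, if_pos hk, h_last k hk]
    cases lastSide L V k <;> simp
  · simp [hk]

theorem fiberOrbit_eq_sideWalk (h_alt : ∀ k, (L (k + 1)).isLeft ≠ (L k).isLeft)
    (h_last : ∀ k, V (k + 1) = true → (L (k + 1)).isLeft = !lastSide L V k)
    {ρ : Monoid.Coprod A B →* (ℝ ≃o ℝ)} (hρ : ∀ g x, |ρ g x - x| < 2)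
    (hρ' : ∀ g x, x < -1 → ρ g x = x) {c : Bool → ℝ} {b : Bool} (hc : c (!b) = -5) (k : ℕ) :
    fiberOrbit L V ρ (c false - c true) (c (L 0).isLeft) k =
      ρ (sideWalk L V b k) (c b) + if lastSide L V k = b then 0 else -5 - c b := by
  induction k with
  | zero =>
    simp only [fiberOrbit, sideWalk, map_one, RelIso.one_apply]
    change c (lastSide L V 0) = _
    obtain h | h : lastSide L V 0 = b ∨ lastSide L V 0 = !b := Bool.eq_or_eq_not _ _
    · simp [h]
    · simp [h, hc]
  | succ k ih =>
    have h_bound := hρ (sideWalk L V b k) (c b)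
    rw [abs_lt] at h_bound
    rw [fiberOrbit, ih, mul_jump h_alt h_last, sideWalk, lastSide]
    obtain h | h : lastSide L V k = b ∨ lastSide L V k = !b := Bool.eq_or_eq_not _ _
    · by_cases hk : V (k + 1) = true
      · simp [h, hk, h_last k hk, RelIso.mul_apply, hc]
      · simp [h, hk, RelIso.mul_apply]
    · have h_fix := hρ' (letter (L k)) (ρ (sideWalk L V b k) (c b) + (-5 - c b)) (by linarith)
      by_cases hk : V (k + 1) = true
      · simp [h, hk, h_last k hk, hc, h_fix]
        ring
      · simp [h, hk, h_fix]

theorem sideWalk_of_not_splits {N : ℕ} (h_alt : ∀ k, (L (k + 1)).isLeft ≠ (L k).isLeft)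
    (h_last : ∀ k, V (k + 1) = true → (L (k + 1)).isLeft = !lastSide L V k) (hV : V 0 = true)
    (hN : V N = true) (hLN : L N = L 0) (h_not : ¬ Splits L V N)
    {ρ : Monoid.Coprod A B →* (ℝ ≃o ℝ)} {c : Bool → ℝ}
    (h_closed : fiberOrbit L V ρ (c false - c true) (c (L 0).isLeft) N = c (L 0).isLeft)
    (b : Bool) : ρ (sideWalk L V b N) (c b) = c b := by
  set O := fiberOrbit L V ρ (c false - c true) (c (L 0).isLeft) with hO
  have h_visit : ∀ k, V k = true → O k = c (L k).isLeft := fun k hk => by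
    rw [hO, fiberOrbit_eq_of_not_splits h_not hV h_closed hk, leftInd, leftInd]
    cases (L 0).isLeft <;> cases (L k).isLeft <;> simp
  have key : ∀ k, O k = ρ (sideWalk L V (lastSide L V k) k) (c (lastSide L V k)) ∧
      ρ (sideWalk L V (!lastSide L V k) k) (c (!lastSide L V k)) = c (!lastSide L V k) := by
    intro k
    induction k with
    | zero => simp [hO, fiberOrbit, sideWalk, lastSide]
    | succ k ih =>
      obtain ⟨ih₁, ih₂⟩ := ih
      have h₁ : O (k + 1) = ρ (letter (L k)) (O k) + _ := rfl
      rw [mul_jump h_alt h_last, ih₁] at h₁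
      by_cases hk : V (k + 1) = true
      · have h₂ := h_visit _ hk
        have h₃ := h_last k hk
        rw [h₃] at h₂
        rw [if_pos hk] at h₁
        simp only [lastSide, hk, if_true, h₃, sideWalk, Bool.not_not, Bool.eq_not_self, if_false,
          ih₂, h₂, map_mul, RelIso.mul_apply, true_and]
        linarith
      · rw [if_neg hk, add_zero] at h₁
        simp [lastSide, hk, sideWalk, h₁, ih₂, RelIso.mul_apply]
  have h_lastN : lastSide L V N = (L 0).isLeft := by rw [lastSide_of_visit hN, hLN]
  obtain ⟨h₁, h₂⟩ := key N
  rw [h_lastN] at h₁ h₂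
  obtain rfl | rfl : b = (L 0).isLeft ∨ b = !(L 0).isLeft := Bool.eq_or_eq_not _ _
  · rw [← h₁, h_closed]
  · exact h₂

theorem splits_of_alternating_visits [Countable A] [Countable B]
    (hA : IsRightOrderable A) (hB : IsRightOrderable B) {N : ℕ}
    (h_nt : ∀ k, IsNontrivialLetter (L k)) (h_alt : ∀ k, (L (k + 1)).isLeft ≠ (L k).isLeft)
    (h_last : ∀ k, V (k + 1) = true → (L (k + 1)).isLeft = !lastSide L V k)
    (hL : ∀ k, L (k + N) = L k) (hVN : ∀ k, V (k + N) = V k) (hN : 0 < N) (hV : V 0 = true)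
    (h_sides : ∀ b, ∃ k, V k = true ∧ (L k).isLeft = b) : Splits L V N := by
  by_contra h_not
  have hN_visit : V N = true := by simpa [hV] using hVN 0
  have hLN : L N = L 0 := by simpa using hL 0
  have h_lastN : lastSide L V N = (L 0).isLeft := by rw [lastSide_of_visit hN_visit, hLN]
  have h_disp : ∀ {ρ : Monoid.Coprod A B →* (ℝ ≃o ℝ)}, (∀ g x, |ρ g x - x| < 2) →
      (∀ g x, x < -1 → ρ g x = x) → ∀ {c : Bool → ℝ} {b : Bool}, c (!b) = -5 →
      fiberOrbit L V ρ (c false - c true) (c (L 0).isLeft) N - c (L 0).isLeft =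
        ρ (sideWalk L V b N) (c b) - c b := by
    intro ρ hρ hρ' c b hc
    rw [fiberOrbit_eq_sideWalk h_alt h_last hρ hρ' hc, h_lastN]
    obtain h | h : (L 0).isLeft = b ∨ (L 0).isLeft = !b := Bool.eq_or_eq_not _ _
    · simp [h]
    · simp [h, hc]
      ring
  by_cases h_one : ∃ b, sideWalk L V b N = 1
  · obtain ⟨b, hb⟩ := h_one
    obtain ⟨k, hk, rfl⟩ := h_sides b
    obtain ⟨l, hkl, hl, h_between⟩ := exists_next_visit (V := V) (k := k)
      ⟨k + N, by omega, by rw [hVN, hk]⟩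
    have h_ne : walk (fun j => L (k + j)) (l - k) ≠ 1 :=
      (walk_ne_walk hA hB (L := fun j => L (k + j)) (fun _ => h_nt _) (fun j => h_alt (k + j))
        (show 0 < l - k by omega)).symm
    obtain ⟨ρ, ξ, -, hρ, hρ', hξ, -⟩ := exists_local_action_coprod hA hB h_ne h_ne
    have h_disp := h_disp hρ hρ' (c := fun b => if b = (L k).isLeft then ξ else -5)
      (b := (L k).isLeft)
      (by cases (L k).isLeft <;> simp)
    rw [hb, map_one, RelIso.one_apply, sub_self, sub_eq_zero] at h_disp
    have h_side : (L l).isLeft ≠ (L k).isLeft := by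
      obtain ⟨m, rfl⟩ : ∃ m, l = m + 1 := ⟨l - 1, by omega⟩
      rw [h_last m hl, lastSide_of_no_visit_between hk (by omega)
        fun i hi hi' => h_between i hi (by omega)]
      exact Bool.not_ne_self _
    have h_orbit := fiberOrbit_eq_of_not_splits h_not hV h_disp hk
    have h_fix := apply_walk_eq_of_not_splits h_not h_alt hV h_disp hk hl hkl h_between h_side
    have : (if (L 0).isLeft = (L k).isLeft then ξ else -5) +
        ((if false = (L k).isLeft then ξ else -5) - (if true = (L k).isLeft then ξ else -5)) *
          (leftInd (L 0) - leftInd (L k)) = ξ := by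
      rw [leftInd, leftInd]
      cases (L 0).isLeft <;> cases (L k).isLeft <;> simp
    rw [h_orbit, this] at h_fix
    exact hξ.ne' h_fix
  · push Not at h_one
    obtain ⟨ρ, ξ, η, hρ, hρ', hξ, hη⟩ := exists_local_action_coprod hA hB (h_one true) (h_one false)
    let D : ℝ → ℝ → ℝ := fun x y =>
      fiberOrbit L V ρ (y - x) (if (L 0).isLeft then x else y) N - if (L 0).isLeft then x else y
    have hD : ∀ x y, D x y = 0 →
        ρ (sideWalk L V true N) x = x ∧ ρ (sideWalk L V false N) y = y := by
      intro x y h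
      have := sideWalk_of_not_splits h_alt h_last hV hN_visit hLN h_not
        (c := fun b => if b then x else y) (ρ := ρ) (sub_eq_zero.1 h)
      exact ⟨by simpa using this true, by simpa using this false⟩
    have hD_left : 0 < D ξ (-5) := by
      have : D ξ (-5) = _ :=
        h_disp hρ hρ' (c := fun b => if b then ξ else -5) (b := true) (by simp)
      rw [this]
      simpa using hξ
    have hD_right : D (-5) η < 0 := by
      have : D (-5) η = _ :=
        h_disp hρ hρ' (c := fun b => if b then -5 else η) (b := false) (by simp)
      rw [this]
      simpa using hη
    have h_cont : Continuous (D ξ) ∧ Continuous fun x => D x η := by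
      have h_left : Continuous fun y => if (L 0).isLeft then ξ else y :=
        continuous_const.if_const _ continuous_id
      have h_right : Continuous fun x => if (L 0).isLeft then x else η :=
        continuous_id.if_const _ continuous_const
      exact ⟨(continuous_fiberOrbit L V ρ (continuous_sub_right ξ) h_left N).sub h_left,
        (continuous_fiberOrbit L V ρ (continuous_sub_left η) h_right N).sub h_right⟩
    rcases le_or_gt (D ξ η) 0 with h | h
    · obtain ⟨y, hy⟩ := mem_range_of_exists_le_of_exists_ge h_cont.1 ⟨η, h⟩ ⟨-5, hD_left.le⟩
      exact hξ.ne' (hD _ _ hy).1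
    · obtain ⟨x, hx⟩ := mem_range_of_exists_le_of_exists_ge h_cont.2 ⟨-5, hD_right.le⟩ ⟨ξ, h.le⟩
      exact hη.ne (hD _ _ hx).2

theorem splits_of_consecutive_isLeft_ne [Countable A] [Countable B]
    (hA : IsRightOrderable A) (hB : IsRightOrderable B) {N : ℕ}
    (h_nt : ∀ k, IsNontrivialLetter (L k)) (h_alt : ∀ k, (L (k + 1)).isLeft ≠ (L k).isLeft)
    (hL : ∀ k, L (k + N) = L k) (hVN : ∀ k, V (k + N) = V k) (hN : 0 < N) (hV : V 0 = true)
    {l : ℕ} (hl : 0 < l) (hl_visit : V l = true) (h_between : ∀ i, 0 < i → i < l → V i = false)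
    (h_side : (L l).isLeft ≠ (L 0).isLeft) : Splits L V N := by
  by_cases hS : ∑ j ∈ Finset.range N, jump L V j = 0
  · by_cases h_last : ∀ k, V (k + 1) = true → (L (k + 1)).isLeft = !lastSide L V k
    · refine splits_of_alternating_visits hA hB h_nt h_alt h_last hL hVN hN hV fun b => ?_
      obtain h | h : b = (L 0).isLeft ∨ b = !(L 0).isLeft := Bool.eq_or_eq_not _ _
      · exact ⟨0, hV, h.symm⟩
      · exact ⟨l, hl_visit, by rw [h]; exact Bool.eq_not.2 h_side⟩
    · push Not at h_last
      obtain ⟨k, hk, h⟩ := h_last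
      exact splits_of_lastSide_eq h_alt hV hS hk (by simpa using Bool.eq_not.2 h)
  · by_contra h_not
    have h_ne : walk L l ≠ 1 := (walk_ne_walk hA hB h_nt h_alt hl).symm
    obtain ⟨ρ, ξ, -, hρ, -, hξ, -⟩ := exists_local_action_coprod hA hB h_ne h_ne
    obtain ⟨t, ht⟩ := exists_fiberOrbit_eq_of_sum_jump_ne_zero hS hρ ξ
    have := apply_walk_eq_of_not_splits h_not h_alt hV ht hV hl_visit hl h_between h_side
    simp only [zero_add, Nat.sub_zero, fiberOrbit] at this
    exact hξ.ne' this

theorem exists_splits [Countable A] [Countable B]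
    (hA : IsRightOrderable A) (hB : IsRightOrderable B) {N : ℕ}
    (h_nt : ∀ k, IsNontrivialLetter (L k)) (h_alt : ∀ k, (L (k + 1)).isLeft ≠ (L k).isLeft)
    (hpow : ∀ (v : Monoid.Coprod A B) (j : ℕ), 2 ≤ j → walk L N ≠ v ^ j)
    (hL : ∀ k, L (k + N) = L k) (hVN : ∀ k, V (k + N) = V k) (hV : V 0 = true)
    {d : ℕ} (hd : 0 < d) (hdN : d < N) (hd_visit : V d = true) :
    ∃ i, V i = true ∧ Splits (fun k => L (i + k)) (fun k => V (i + k)) N := by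
  classical
  by_cases h_side : ∀ k, V k = true → (L k).isLeft = (L 0).isLeft
  · refine ⟨0, hV, ?_⟩
    simp only [zero_add]
    exact splits_of_forall_isLeft_eq hA hB h_alt (by simpa [hV] using hVN 0) hpow hV hd hdN
      hd_visit h_side
  · push Not at h_side
    obtain ⟨hm, hm_side⟩ := Nat.find_spec h_side
    have hm_min := fun j hj => Nat.find_min h_side (m := j) hj
    set m := Nat.find h_side
    have hm0 : 0 < m := Nat.pos_of_ne_zero fun h => hm_side (by rw [h])
    obtain ⟨i, him, hi, h_between⟩ := exists_last_visit hV hm0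
    have hi_side : (L i).isLeft = (L 0).isLeft := by
      by_contra h
      exact hm_min i him ⟨hi, h⟩
    refine ⟨i, hi, splits_of_consecutive_isLeft_ne hA hB (fun _ => h_nt _) (fun k => h_alt (i + k))
      (fun k => by rw [← add_assoc, hL]) (fun k => by rw [← add_assoc, hVN]) (by omega) hi
      (l := m - i) (by omega) ?_ (fun j hj hj' => h_between _ (by omega) (by omega)) ?_⟩
    · rwa [show i + (m - i) = m by omega]
    · rw [show i + (m - i) = m by omega, add_zero, hi_side]
      exact hm_side

end Alternating

end Split

section Refinement

variable {A B : Type*} [Group A] [Group B]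

theorem periodic_walk_apply {L : ℕ → A ⊕ B} {N : ℕ} (hL : ∀ k, L (k + N) = L k) {X : Type*}
    [LinearOrder X] {θ : Monoid.Coprod A B →* (X ≃o X)} {x : X} (hx : θ (walk L N) x = x) :
    Function.Periodic (fun k => θ (walk L k) x) N := fun k => by
  have : (fun j => L (N + j)) = L := funext fun j => by rw [add_comm, hL]
  dsimp only
  rw [add_comm, walk_add, this, map_mul, RelIso.mul_apply, hx]

/-- A periodic orbit which returns to its starting point too early can be lifted to a periodic orbit
with fewer coincidences. -/
theorem exists_refinement [Countable A] [Countable B]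
    (hA : IsRightOrderable A) (hB : IsRightOrderable B) {L : ℕ → A ⊕ B} {N : ℕ}
    (h_nt : ∀ k, IsNontrivialLetter (L k)) (h_alt : ∀ k, (L (k + 1)).isLeft ≠ (L k).isLeft)
    (hpow : ∀ (v : Monoid.Coprod A B) (j : ℕ), 2 ≤ j → walk L N ≠ v ^ j)
    (hL : ∀ k, L (k + N) = L k) {m : ℕ} (hm : 0 < m) (hmN : m < N) {X : Type} [LinearOrder X]
    {θ : Monoid.Coprod A B →* (X ≃o X)} {x : X} (hx : θ (walk L N) x = x)
    (hmx : θ (walk L m) x = x) :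
    ∃ (Y : Type) (_ : LinearOrder Y) (Θ : Monoid.Coprod A B →* (Y ≃o Y)) (y : Y),
      Θ (walk L N) y = y ∧
      (∀ k l, Θ (walk L k) y = Θ (walk L l) y → θ (walk L k) x = θ (walk L l) x) ∧
      ∃ k l, θ (walk L k) x = θ (walk L l) x ∧ Θ (walk L k) y ≠ Θ (walk L l) y := by
  classical
  have h_per := periodic_walk_apply hL hx
  let V : ℕ → Bool := fun k => θ (walk L k) x = x
  have hV : ∀ k, V k = true ↔ θ (walk L k) x = x := fun k => by simp [V]
  have hVN : ∀ k, V (k + N) = V k := fun k => by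
    have := h_per k
    simp only at this
    simp only [V, this]
  obtain ⟨i, hi, ρ, t, o, h_closed, k, hk, h_ne⟩ := exists_splits hA hB h_nt h_alt hpow hL hVN
    ((hV 0).2 (by simp [walk])) hm hmN ((hV m).2 hmx)
  set L' := fun k => L (i + k) with hL'
  set V' := fun k => V (i + k) with hV'
  set Θ := twistedAction θ ρ x t with hΘ
  set y := (Θ (walk L i))⁻¹ (toLex (θ (walk L i) x, fiberPoint L' V' ρ t o 0)) with hy
  have h_orbit : ∀ k, Θ (walk L (i + k)) y = toLex (θ (walk L (i + k)) x,
      fiberPoint L' V' ρ t o k) := fun k => by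
    rw [walk_add, map_mul, RelIso.mul_apply, hy, RelIso.apply_inv_self, hΘ, twistedAction_walk,
      map_mul, RelIso.mul_apply]
    intro k
    rw [hV', hV, walk_add, map_mul, RelIso.mul_apply]
  have hy_fix : Θ (walk L N) y = y := by
    have h₁ : fiberPoint L' V' ρ t o N = fiberPoint L' V' ρ t o 0 := by
      have hVi : V' N = V' 0 := hVN i
      have hLi : L' N = L' 0 := hL i
      rw [fiberPoint, fiberPoint, h_closed, hVi, hLi, fiberOrbit]
    have h₂ := h_orbit N
    have h₃ := h_per i
    simp only at h₃
    rw [h₁, h₃, show Θ (walk L (i + N)) y = Θ (walk L i) (Θ (walk L N) y) by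
      rw [add_comm, walk_add, map_mul, RelIso.mul_apply]
      congr 3
      funext j
      rw [add_comm, hL]] at h₂
    exact (Θ (walk L i)).injective (h₂.trans (h_orbit 0).symm)
  have h_per' := periodic_walk_apply hL hy_fix
  refine ⟨X ×ₗ ℝ, inferInstance, Θ, y, hy_fix, fun k l h_eq => ?_, i + k, i, ?_, fun h_eq => ?_⟩
  · have h_index : ∀ k, ∃ j, k + i * N = i + j := fun k =>
      ⟨k + i * N - i, by nlinarith [Nat.sub_add_cancel (show i ≤ k + i * N by nlinarith)]⟩
    obtain ⟨k', hk'⟩ := h_index k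
    obtain ⟨l', hl'⟩ := h_index l
    have h₁ := h_per.nat_mul i
    have h₂ := h_per'.nat_mul i
    simp only [Function.Periodic, Nat.cast_id] at h₁ h₂
    rw [← h₂ k, ← h₂ l, hk', hl', h_orbit, h_orbit, ← hk', ← hl', h₁, h₁] at h_eq
    exact (Prod.mk.inj (toLex.injective h_eq)).1
  · rw [(hV _).1 hk, (hV _).1 hi]
  · have h₀ := h_orbit 0
    rw [add_zero] at h₀
    rw [h_orbit, h₀] at h_eq
    exact h_ne (Prod.mk.inj (toLex.injective h_eq)).2

theorem exists_action_walk_ne [Countable A] [Countable B]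
    (hA : IsRightOrderable A) (hB : IsRightOrderable B) {L : ℕ → A ⊕ B} {N : ℕ}
    (h_nt : ∀ k, IsNontrivialLetter (L k)) (h_alt : ∀ k, (L (k + 1)).isLeft ≠ (L k).isLeft)
    (hpow : ∀ (v : Monoid.Coprod A B) (j : ℕ), 2 ≤ j → walk L N ≠ v ^ j)
    (hL : ∀ k, L (k + N) = L k) {m : ℕ} (hm : 0 < m) (hmN : m < N) :
    ∃ (X : Type) (_ : LinearOrder X) (θ : Monoid.Coprod A B →* (X ≃o X)) (x : X),
      θ (walk L N) x = x ∧ θ (walk L m) x ≠ x := by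
  classical
  suffices h : ∀ (c : ℕ) (X : Type) (_ : LinearOrder X) (θ : Monoid.Coprod A B →* (X ≃o X)) (x : X),
      θ (walk L N) x = x →
      ((Finset.range N ×ˢ Finset.range N).filter
        fun p => θ (walk L p.1) x = θ (walk L p.2) x).card = c →
      ∃ (X : Type) (_ : LinearOrder X) (θ : Monoid.Coprod A B →* (X ≃o X)) (x : X),
        θ (walk L N) x = x ∧ θ (walk L m) x ≠ x from
    h _ Unit inferInstance 1 () rfl rfl
  intro c
  induction c using Nat.strong_induction_on with
  | _ c ih =>
    intro X _ θ x hx hc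
    by_cases hmx : θ (walk L m) x = x
    swap
    · exact ⟨X, inferInstance, θ, x, hx, hmx⟩
    obtain ⟨Y, _, Θ, y, hy, h_finer, k, l, h_eq, h_ne⟩ :=
      exists_refinement hA hB h_nt h_alt hpow hL hm hmN hx hmx
    refine ih _ ?_ Y inferInstance Θ y hy rfl
    rw [← hc]
    refine Finset.card_lt_card (Finset.ssubset_iff_of_subset ?_ |>.2 ⟨(k % N, l % N), ?_, ?_⟩)
    · exact Finset.monotone_filter_right _ fun p _ => h_finer p.1 p.2
    · have hk := (periodic_walk_apply hL hx).map_mod_nat k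
      have hl := (periodic_walk_apply hL hx).map_mod_nat l
      simp [hk, hl, h_eq, Nat.mod_lt _ (hm.trans hmN)]
    · have hk := (periodic_walk_apply hL hy).map_mod_nat k
      have hl := (periodic_walk_apply hL hy).map_mod_nat l
      simp [hk, hl, h_ne]

theorem wordLetters_eq_ofFn {n : ℕ} (a : Fin n → A) (b : Fin n → B) :
    wordLetters a b = List.ofFn fun k : Fin (2 * n) =>
      if (k : ℕ) % 2 = 0 then Monoid.Coprod.inl (a ⟨k / 2, by omega⟩)
      else Monoid.Coprod.inr (b ⟨k / 2, by omega⟩) := by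
  rw [List.ofFn_mul', wordLetters, List.flatMap, List.ofFn_eq_map]
  congr 2
  funext i
  simp [List.ofFn_succ, Nat.add_div]

end Refinement

theorem exists_action_fixing_w_moving_prefix
    {A B : Type*} [Group A] [Group B] [Countable A] [Countable B]
    (hA : IsRightOrderable A) (hB : IsRightOrderable B)
    {n : ℕ} (hn : 1 ≤ n) (a : Fin n → A) (b : Fin n → B)
    (ha : ∀ i, a i ≠ 1) (hb : ∀ i, b i ≠ 1)
    (hpow : ¬ ∃ (v : Monoid.Coprod A B) (j : ℤ), 2 ≤ j ∧ (wordLetters a b).prod = v ^ j)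
    (m : ℕ) (hm : 1 ≤ m) (hm' : m < 2 * n) :
    ∃ (τ : Monoid.Coprod A B → (ℝ ≃o ℝ)) (x : ℝ),
      IsRightAction τ ∧
      τ ((wordLetters a b).prod) x = x ∧
      τ (((wordLetters a b).take m).prod) x ≠ x := by
  have : NeZero n := ⟨by omega⟩
  let L : ℕ → A ⊕ B := fun k =>
    if k % 2 = 0 then Sum.inl (a (Fin.ofNat n (k / 2)))⁻¹ else Sum.inr (b (Fin.ofNat n (k / 2)))⁻¹
  have h_nt : ∀ k, IsNontrivialLetter (L k) := fun k => by
    dsimp only [L]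
    split_ifs <;> simp [IsNontrivialLetter, ha, hb]
  have h_alt : ∀ k, (L (k + 1)).isLeft ≠ (L k).isLeft := fun k => by
    dsimp only [L]
    rcases Nat.mod_two_eq_zero_or_one k with h | h <;> simp [h, Nat.add_mod]
  have hL : ∀ k, L (k + 2 * n) = L k := fun k => by
    have h₁ : (k + 2 * n) / 2 = k / 2 + n := by omega
    have h₂ : Fin.ofNat n (k / 2 + n) = Fin.ofNat n (k / 2) := by simp [Fin.ofNat]
    simp only [L, h₁, h₂, Nat.add_mul_mod_self_left]
  have h_walk : ∀ k ≤ 2 * n, walk L k = ((wordLetters a b).take k).prod⁻¹ := by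
    intro k hk
    induction k with
    | zero => simp [walk]
    | succ k ih =>
      have hk' : k < (wordLetters a b).length := by
        rw [wordLetters_eq_ofFn, List.length_ofFn]
        omega
      have h₁ : Fin.ofNat n (k / 2) = ⟨k / 2, by omega⟩ :=
        Fin.ext (Nat.mod_eq_of_lt (by omega))
      rw [walk, ih (by omega), List.prod_take_succ _ _ hk', mul_inv_rev]
      congr 1
      simp only [wordLetters_eq_ofFn, List.getElem_ofFn, L, h₁]
      split_ifs <;> simp [letter]
  have h_length : (wordLetters a b).length = 2 * n := by
    rw [wordLetters_eq_ofFn, List.length_ofFn]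
  have h_word : walk L (2 * n) = (wordLetters a b).prod⁻¹ := by
    rw [h_walk _ le_rfl, ← h_length, List.take_length]
  obtain ⟨X, _, θ, x, hx, hmx⟩ := exists_action_walk_ne hA hB h_nt h_alt
    (fun v j hj h_eq => hpow ⟨v⁻¹, j, by exact_mod_cast hj, by
      rw [zpow_natCast, inv_pow, ← h_eq, h_word, inv_inv]⟩) hL hm hm'
  obtain ⟨ρ, ξ, hρ⟩ := exists_real_action_with_stabilizer θ x
  refine ⟨fun g => ρ g⁻¹, ξ, fun g h => ?_, ?_, fun h => hmx ?_⟩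
  · change ρ (g * h)⁻¹ = (ρ g⁻¹).trans (ρ h⁻¹)
    rw [mul_inv_rev, map_mul]
    rfl
  · change ρ (wordLetters a b).prod⁻¹ ξ = ξ
    rw [← h_word]
    exact (hρ _).2 hx
  · rw [h_walk m hm'.le]
    exact (hρ _).1 h
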